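/- arXiv:1504.06312 — 3 statements merged into one kernel-verified Lean document; each statement's English description precedes it below -/
import Mathlib

section
/- Let σ, K, a be real numbers with σ > 0, K > 1 and 0 < a < σ²/(1+σ), and define f : ℝ → ℝ by f(s) = K(σ−a)/((K−1)s + σ − Ka). Then for every s in [a, σ] the identity (((K·(s−a) + (σ−s))²) / (K·(σ−a))) · (σ·f(s)² + f(s) + s·f'(s)) = K·σ² − a·K·σ + σ − K·a holds, where f'(s) denotes the derivative of f at s. -/
/-- The key identity from the proof of the stabilization lemma (Lemma 3.3 of the paper):
for `f(s) = K(σ-a)/((K-1)s + σ - Ka)` and `s ∈ [a, σ]`,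
`((K(s-a) + (σ-s))² / (K(σ-a))) · (σ f(s)² + f(s) + s f'(s)) = Kσ² - aKσ + σ - Ka`. -/
theorem stmt_2 (σ K a : ℝ) (hσ : 0 < σ) (hK : 1 < K)
    (ha0 : 0 < a) (ha : a < σ ^ 2 / (1 + σ))
    (f : ℝ → ℝ) (hf : ∀ s, f s = K * (σ - a) / ((K - 1) * s + σ - K * a)) :
    ∀ s ∈ Set.Icc a σ,
      ((K * (s - a) + (σ - s)) ^ 2 / (K * (σ - a))) *
          (σ * f s ^ 2 + f s + s * deriv f s) =
        K * σ ^ 2 - a * K * σ + σ - K * a := by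
  rintro s ⟨has, hsσ⟩
  have haσ : 0 < σ - a := by
    rw [lt_div_iff₀ (by positivity)] at ha
    nlinarith
  have hD : 0 < (K - 1) * s + σ - K * a := by
    nlinarith [mul_nonneg (sub_nonneg.2 hK.le) (sub_nonneg.2 has)]
  have hderiv : HasDerivAt f
      (-(K * (σ - a) * (K - 1)) / ((K - 1) * s + σ - K * a) ^ 2) s := by
    have hden : HasDerivAt (fun x => (K - 1) * x + σ - K * a) (K - 1) s := by
      simpa using (((hasDerivAt_id s).const_mul (K - 1)).add_const σ).sub_const (K * a)
    rw [funext hf]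
    simpa using (hasDerivAt_const s (K * (σ - a))).fun_div hden hD.ne'
  have hK0 : K ≠ 0 := by positivity
  have hσa := haσ.ne'
  have hD0 := hD.ne'
  rw [hderiv.deriv, hf,
    show K * (s - a) + (σ - s) = (K - 1) * s + σ - K * a by ring]
  field_simp
  ring
end

section
/- Let σ, K, a be real numbers with σ > 0, K > 1 and 0 < a < σ²/(1+σ), and define f : ℝ → ℝ by f(s) = K(σ−a)/((K−1)s + σ − Ka). Then for every s in the closed interval [a, σ] one has σ·f(s)² + f(s) + s·f'(s) > 0, where f'(s) denotes the derivative of f at s. -/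
/-- Inequality (2) of the paper for the explicit rational function
`f(s) = K(σ-a)/((K-1)s + σ - Ka)`: for all `s ∈ [a, σ]`,
`σ f(s)² + f(s) + s f'(s) > 0`. (Lemma 3.3 of the paper.) -/
theorem stmt_4 (σ K a : ℝ) (hσ : 0 < σ) (hK : 1 < K)
    (ha0 : 0 < a) (ha : a < σ ^ 2 / (1 + σ))
    (f : ℝ → ℝ) (hf : ∀ s, f s = K * (σ - a) / ((K - 1) * s + σ - K * a)) :
    ∀ s ∈ Set.Icc a σ, 0 < σ * f s ^ 2 + f s + s * deriv f s := by
  rintro s ⟨hs, -⟩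
  have hgap : 0 < σ ^ 2 - σ * a - a := by
    rw [lt_div_iff₀ (by positivity)] at ha
    linarith
  have hσa : 0 < σ - a := by nlinarith
  have hD : 0 < (K - 1) * s + σ - K * a := by
    nlinarith [mul_nonneg (sub_nonneg.2 hK.le) (sub_nonneg.2 hs)]
  have hlin : HasDerivAt (fun x : ℝ => (K - 1) * x + σ - K * a) (K - 1) s := by
    simpa using (((hasDerivAt_id s).const_mul (K - 1)).add_const σ).sub_const (K * a)
  have hderiv : deriv f s =
      -(K * (σ - a) * (K - 1)) / ((K - 1) * s + σ - K * a) ^ 2 := by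
    rw [funext hf]
    simpa using ((hasDerivAt_const s (K * (σ - a))).fun_div hlin hD.ne').deriv
  have hexpr : σ * f s ^ 2 + f s + s * deriv f s =
      K * (σ - a) * (K * (σ ^ 2 - σ * a - a) + σ) / ((K - 1) * s + σ - K * a) ^ 2 := by
    rw [hderiv, hf]
    field_simp
    ring
  rw [hexpr]
  positivity
end

section
/- Let σ, K, a be real numbers with σ > 0, K > 1 and 0 < a < σ²/(1+σ). Then there exists an infinitely differentiable function f : ℝ → ℝ such that: f(s) = K for all s in a neighborhood of (−∞, a]; f(s) = 1 for all s in a neighborhood of [σ, ∞); 1 ≤ f(s) ≤ K for all s; and σ·f(s)² + f(s) + s·f'(s) > 0 for all s in [a, σ]. In particular the function s ↦ f(s)·s/(σ·f(s) + 1) is strictly increasing on [a, σ]. -/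
/-- For `r < b / a` there is a smooth monotone function, constant near `(-∞, a]` and near `[b, ∞)`,
which grows at most as fast as `Real.log` but increases by more than `log r`. -/
lemma exists_smooth_primitive_cutoff_inv {a b r : ℝ} (ha : 0 < a) (hab : a < b) (hr : 0 < r)
    (h : r * a < b) :
    ∃ (F : ℝ → ℝ) (ε : ℝ), 0 < ε ∧ ContDiff ℝ (⊤ : ℕ∞) F ∧ Monotone F ∧
      (∀ s ≤ a + ε, F s = 0) ∧ (∀ s, b - ε ≤ s → F s = F b) ∧
      (∀ s, s * deriv F s ≤ 1) ∧ Real.log r < F b := by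
  obtain ⟨ε, hε, hεab, hεr⟩ : ∃ ε : ℝ, 0 < ε ∧ 4 * ε < b - a ∧ r * (a + 2 * ε) < b - 2 * ε := by
    have h1 : ∀ᶠ ε : ℝ in nhds 0, 4 * ε < b - a := by
      apply ContinuousAt.eventually_lt (by fun_prop) (by fun_prop)
      linarith
    have h2 : ∀ᶠ ε : ℝ in nhds 0, r * (a + 2 * ε) < b - 2 * ε := by
      apply ContinuousAt.eventually_lt (by fun_prop) (by fun_prop)
      simpa using h
    have h3 := (h1.and h2).filter_mono (nhdsWithin_le_nhds (s := Set.Ioi 0))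
    obtain ⟨ε, ⟨h1, h2⟩, h3⟩ := (h3.and self_mem_nhdsWithin).exists
    exact ⟨ε, h3, h1, h2⟩
  let χ : ContDiffBump ((a + b) / 2 : ℝ) :=
    { rIn := (b - a) / 2 - 2 * ε
      rOut := (b - a) / 2 - ε
      rIn_pos := by linarith
      rIn_lt_rOut := by linarith }
  have hχl : ∀ t ≤ a + ε, χ t = 0 := fun t ht => χ.zero_of_le_dist (by
    rw [Real.dist_eq]
    exact le_trans (by change (b - a) / 2 - ε ≤ _; linarith) (neg_le_abs _))
  have hχr : ∀ t, b - ε ≤ t → χ t = 0 := fun t ht => χ.zero_of_le_dist (by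
    rw [Real.dist_eq]
    exact le_trans (by change (b - a) / 2 - ε ≤ _; linarith) (le_abs_self _))
  have hχm : ∀ t ∈ Set.Icc (a + 2 * ε) (b - 2 * ε), χ t = 1 := fun t ht =>
    χ.one_of_mem_closedBall (by
      rw [Metric.mem_closedBall, Real.dist_eq, abs_le]
      change -((b - a) / 2 - 2 * ε) ≤ _ ∧ _ ≤ (b - a) / 2 - 2 * ε
      constructor <;> linarith [ht.1, ht.2])
  let ψ : ℝ → ℝ := fun t => χ t * t⁻¹
  have hψ : ContDiff ℝ (⊤ : ℕ∞) ψ := by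
    rw [contDiff_iff_contDiffAt]
    intro t
    rcases lt_or_ge t (a + ε) with ht | ht
    · refine contDiffAt_const (c := (0 : ℝ)) |>.congr_of_eventuallyEq ?_
      filter_upwards [Iio_mem_nhds ht] with x hx
      simp [ψ, hχl x (le_of_lt hx)]
    · exact χ.contDiffAt.mul (contDiffAt_inv ℝ (by linarith : 0 < t).ne')
  have hψ0 : ∀ t, 0 ≤ ψ t := by
    intro t
    rcases le_or_gt t (a + ε) with ht | ht
    · simp [ψ, hχl t ht]
    · exact mul_nonneg χ.nonneg (inv_nonneg.2 (by linarith))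
  have hint : ∀ x y, IntervalIntegrable ψ MeasureTheory.volume x y :=
    fun x y => hψ.continuous.intervalIntegrable x y
  let F : ℝ → ℝ := fun x => ∫ t in a..x, ψ t
  have hF : ∀ x, HasDerivAt F (ψ x) x := fun x =>
    (hψ.continuous.integral_hasStrictDerivAt a x).hasDerivAt
  have hdF : deriv F = ψ := funext fun x => (hF x).deriv
  have hmono : Monotone F :=
    monotone_of_deriv_nonneg (fun x => (hF x).differentiableAt) (by simpa [hdF] using hψ0)
  have hsub : ∀ x y, F y - F x = ∫ t in x..y, ψ t := fun x y =>
    intervalIntegral.integral_interval_sub_left (hint _ _) (hint _ _)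
  have hFl : ∀ s ≤ a + ε, F s = 0 := fun s hs =>
    intervalIntegral.integral_zero_ae (.of_forall fun t ht => by
      have := ht.2.trans (max_le (by linarith) hs)
      simp [ψ, hχl t this])
  refine ⟨F, ε, hε, ?_, hmono, hFl, ?_, ?_, ?_⟩
  · rw [contDiff_infty_iff_deriv]
    exact ⟨fun x => (hF x).differentiableAt, hdF ▸ hψ⟩
  · intro s hs
    rw [← sub_eq_zero, hsub]
    refine intervalIntegral.integral_zero_ae (.of_forall fun t ht => ?_)
    have := (le_min (by linarith) hs).trans ht.1.le
    simp [ψ, hχr t this]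
  · intro s
    rw [hdF]
    rcases eq_or_ne s 0 with rfl | hs
    · simp
    · have : s * ψ s = χ s := by simp only [ψ]; field_simp
      exact this ▸ χ.le_one
  · have h1 : F (b - 2 * ε) - F (a + 2 * ε) = Real.log ((b - 2 * ε) / (a + 2 * ε)) := by
      rw [hsub, ← integral_inv_of_pos (by linarith) (by linarith)]
      refine intervalIntegral.integral_congr fun t ht => ?_
      rw [Set.uIcc_of_le (by linarith)] at ht
      simp [ψ, hχm t ht]
    have h2 : F (b - 2 * ε) ≤ F b := hmono (by linarith)
    have h3 : 0 ≤ F (a + 2 * ε) := by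
      rw [← hFl (a + ε) le_rfl]
      exact hmono (by linarith)
    have h4 : Real.log r < Real.log ((b - 2 * ε) / (a + 2 * ε)) :=
      Real.log_lt_log hr ((lt_div_iff₀ (by linarith)).2 hεr)
    linarith

/-- If `q / p < b / a`, then one can interpolate smoothly from `p` near `(-∞, a]` to `q` near
`[b, ∞)` by a function `w` whose logarithmic derivative is smaller than `1 / s`. -/
lemma exists_smooth_interpolation_mul_deriv_lt {a b p q : ℝ} (ha : 0 < a) (hab : a < b)
    (hp : 0 < p) (hpq : p < q) (h : q * a < p * b) :
    ∃ w : ℝ → ℝ, ContDiff ℝ (⊤ : ℕ∞) w ∧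
      (∀ᶠ s in nhdsSet (Set.Iic a), w s = p) ∧
      (∀ᶠ s in nhdsSet (Set.Ici b), w s = q) ∧
      (∀ s, p ≤ w s ∧ w s ≤ q) ∧
      (∀ s, s * deriv w s < w s) := by
  obtain ⟨F, ε, hε, hF, hmono, hFl, hFr, hd, hlog⟩ :=
    exists_smooth_primitive_cutoff_inv (r := q / p) ha hab (div_pos (hp.trans hpq) hp)
      (by rw [div_mul_eq_mul_div, div_lt_iff₀ hp]; linarith)
  have hL : 0 < Real.log (q / p) := Real.log_pos ((one_lt_div hp).2 hpq)
  have hFb : 0 < F b := hL.trans hlog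
  set c := Real.log (q / p) / F b with hc
  have hc0 : 0 < c := div_pos hL hFb
  have hc1 : c < 1 := (div_lt_one hFb).2 hlog
  let w : ℝ → ℝ := fun s => p * Real.exp (c * F s)
  have hwl : ∀ s ≤ a + ε, w s = p := fun s hs => by simp [w, hFl s hs]
  have hwr : ∀ s, b - ε ≤ s → w s = q := fun s hs => by
    simp only [w, hFr s hs, hc]
    rw [div_mul_cancel₀ _ hFb.ne', Real.exp_log (div_pos (hp.trans hpq) hp)]
    field_simp
  have hwm : Monotone w := fun x y hxy => by
    have := hmono hxy
    simp only [w]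
    gcongr
  refine ⟨w, by fun_prop, ?_, ?_, fun s => ⟨?_, ?_⟩, fun s => ?_⟩
  · filter_upwards [isOpen_Iio.mem_nhdsSet.2 (Set.Iic_subset_Iio.2 (by linarith : a < a + ε))]
      with s hs using hwl s (le_of_lt hs)
  · filter_upwards [isOpen_Ioi.mem_nhdsSet.2 (Set.Ici_subset_Ioi.2 (by linarith : b - ε < b))]
      with s hs using hwr s (le_of_lt hs)
  · rw [← hwl (min s a) (by linarith [min_le_right s a])]
    exact hwm (min_le_left _ _)
  · rw [← hwr (max s b) (by linarith [le_max_right s b])]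
    exact hwm (le_max_left _ _)
  · have hFs : HasDerivAt F (deriv F s) s :=
      (hF.differentiable (by simp) s).hasDerivAt
    have hws : HasDerivAt w (p * (Real.exp (c * F s) * (c * deriv F s))) s :=
      ((hFs.const_mul c).exp).const_mul p
    have h0 : 0 < w s := mul_pos hp (Real.exp_pos _)
    rw [hws.deriv]
    have h1 : c * (s * deriv F s) < 1 := by nlinarith [hd s]
    calc s * (p * (Real.exp (c * F s) * (c * deriv F s))) = w s * (c * (s * deriv F s)) := by
          simp only [w]; ring
      _ < w s * 1 := by gcongr
      _ = w s := mul_one _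

/-- The analytic core of the stabilization lemma (Lemma 3.3 of the paper): for
`σ > 0`, `K > 1` and `0 < a < σ²/(1+σ)` there is a smooth function `f : ℝ → ℝ`
equal to `K` near `(-∞, a]`, equal to `1` near `[σ, ∞)`, with `1 ≤ f ≤ K`
everywhere, satisfying the differential inequality `σ f² + f + s f' > 0` on
`[a, σ]` (inequality (2) of the paper); in particular `s ↦ f(s)·s/(σ f(s)+1)` is
strictly increasing on `[a, σ]`. -/
theorem stmt_8 (σ K a : ℝ) (hσ : 0 < σ) (hK : 1 < K)
    (ha0 : 0 < a) (ha : a < σ ^ 2 / (1 + σ)) :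
    ∃ f : ℝ → ℝ, ContDiff ℝ (⊤ : ℕ∞) f ∧
      (∀ᶠ s in nhdsSet (Set.Iic a), f s = K) ∧
      (∀ᶠ s in nhdsSet (Set.Ici σ), f s = 1) ∧
      (∀ s, 1 ≤ f s ∧ f s ≤ K) ∧
      (∀ s ∈ Set.Icc a σ, 0 < σ * f s ^ 2 + f s + s * deriv f s) ∧
      StrictMonoOn (fun s => f s * s / (σ * f s + 1)) (Set.Icc a σ) := by
  have hu : 0 < 1 / K := by positivity
  have hu1 : 1 / K < 1 := (div_lt_one (by linarith)).2 hK
  rw [lt_div_iff₀ (by linarith)] at ha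
  obtain ⟨w, hw, hwl, hwr, hwb, hwd⟩ :=
    exists_smooth_interpolation_mul_deriv_lt (b := σ) (p := σ + 1 / K) (q := σ + 1) ha0
      (by nlinarith) (by linarith) (by linarith) (by nlinarith)
  have hpos : ∀ s, 0 < w s - σ := fun s => by linarith [(hwb s).1]
  have hwpos : ∀ s, 0 < w s := fun s => by linarith [hpos s]
  have hwD : Differentiable ℝ w := hw.differentiable (by simp)
  refine ⟨fun s => (w s - σ)⁻¹, (hw.sub contDiff_const).inv fun s => (hpos s).ne', ?_, ?_,
    fun s => ⟨?_, ?_⟩, fun s _ => ?_, ?_⟩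
  · filter_upwards [hwl] with s hs
    simp [hs]
  · filter_upwards [hwr] with s hs
    simp [hs]
  · exact (one_le_inv₀ (hpos s)).2 (by linarith [(hwb s).2])
  · rw [inv_le_comm₀ (hpos s) (by linarith), ← one_div]
    linarith [(hwb s).1]
  · have hd : HasDerivAt (fun s => (w s - σ)⁻¹) (-deriv w s / (w s - σ) ^ 2) s :=
      ((hwD s).hasDerivAt.sub_const σ).fun_inv (hpos s).ne'
    have hne := (hpos s).ne'
    rw [hd.deriv]
    have key : σ * ((w s - σ)⁻¹) ^ 2 + (w s - σ)⁻¹ + s * (-deriv w s / (w s - σ) ^ 2)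
        = (w s - s * deriv w s) / (w s - σ) ^ 2 := by
      field_simp
      ring
    rw [key]
    exact div_pos (sub_pos.2 (hwd s)) (pow_pos (hpos s) 2)
  · have heq : (fun s => (w s - σ)⁻¹ * s / (σ * (w s - σ)⁻¹ + 1)) = fun s => s / w s := by
      funext s
      have h1 := (hpos s).ne'
      have h2 := (hwpos s).ne'
      have h3 : σ * (w s - σ)⁻¹ + 1 = w s * (w s - σ)⁻¹ := by
        field_simp
        ring
      rw [h3]
      field_simp
    simp only [heq]
    refine (strictMono_of_deriv_pos fun s => ?_).strictMonoOn _
    have hd : HasDerivAt (fun s => s / w s) ((1 * w s - s * deriv w s) / w s ^ 2) s :=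
      (hasDerivAt_id s).fun_div (hwD s).hasDerivAt (hwpos s).ne'
    rw [hd.deriv, one_mul]
    exact div_pos (sub_pos.2 (hwd s)) (pow_pos (hwpos s) 2)
end
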